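/- Let r₁ = p₁/q₁ < −2 and r₂ = p₂/q₂ > 2 be rational numbers in lowest terms with d₁(r₁,r₂) + d₂(r₁,r₂) < 2π. Let C ⊆ ℝ² be a closed set such that: (a) C is invariant under the translations (θ,η) ↦ (θ+π, η) and (θ,η) ↦ (θ, η+2π); (b) there exists ε > 0 such that every (θ,η) ∈ C whose distance from the set {(kπ, y) : k ∈ ℤ, y ∈ ℝ} in the θ-coordinate is at most ε (i.e. |θ − kπ| ≤ ε for some integer k) satisfies η ∈ 2πℤ; (c) every (θ,η) ∈ C ∩ (S(r₁) ∪ S(r₂)) satisfies η ∈ 2πℤ. Then there exists a smooth, odd, 2π-periodic function g : ℝ → ℝ with |g| < π everywhere, such that for every (θ,η) ∈ C one has η − π ≠ g(θ). -/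

import Mathlib

open Real

/-- The set `S(p/q) = {(θ,η) : pθ+qη ∈ 2πℤ or pθ+pπ+qη ∈ 2πℤ}`. -/
def Spq (p q : ℤ) : Set (ℝ × ℝ) :=
  {x | (∃ k : ℤ, (p : ℝ) * x.1 + (q : ℝ) * x.2 = 2 * π * k) ∨
       (∃ k : ℤ, (p : ℝ) * x.1 + (p : ℝ) * π + (q : ℝ) * x.2 = 2 * π * k)}

/-- The set `Ŝ(p/q) = {(θ,η) : pθ+qη ∈ πℤ}`. -/
def Shat (p q : ℤ) : Set (ℝ × ℝ) :=
  {x | ∃ k : ℤ, (p : ℝ) * x.1 + (q : ℝ) * x.2 = π * k}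

/-- The open strip `W* = ℝ × (0, 2π)`. -/
def Wstar : Set (ℝ × ℝ) :=
  {x | 0 < x.2 ∧ x.2 < 2 * π}

/-- Two points `a ≠ b` are adjacent in `L` relative to the set `X` of intersection points:
they lie on the same connected component of `L` and no point of `X` lies strictly
between them. -/
def AdjacentIn (L X : Set (ℝ × ℝ)) (a b : ℝ × ℝ) : Prop :=
  a ≠ b ∧ b ∈ connectedComponentIn L a ∧ ∀ c ∈ X, c ∉ openSegment ℝ a b

/-- The quantity `d₁(r₁,r₂)` of the paper, where `r₁ = p₁/q₁` and `r₂ = p₂/q₂`: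
`2π|p₁|/Δ(r₁,r₂)` if `p₂` is even, and `π|p₁|/Δ(r₁,r₂)` if `p₂` is odd
(`d₂(r₁,r₂)` is obtained by swapping the roles of the two fractions). -/
noncomputable def dd (p₁ q₁ p₂ q₂ : ℤ) : ℝ :=
  if Even p₂ then 2 * π * |(p₁ : ℝ)| / |((p₁ * q₂ - p₂ * q₁ : ℤ) : ℝ)|
  else π * |(p₁ : ℝ)| / |((p₁ * q₂ - p₂ * q₁ : ℤ) : ℝ)|

/-- The spacing of the values of `pθ + qη` on `S(p/q)`. -/
noncomputable def Spq.spacing (p : ℤ) : ℝ :=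
  if Even p then 2 * π else π

lemma Spq.spacing_pos (p : ℤ) : 0 < Spq.spacing p := by
  unfold Spq.spacing
  split_ifs <;> positivity

lemma Spq.exists_mul_pi_eq (p : ℤ) : ∃ m : ℤ, (p : ℝ) * π = Spq.spacing p * m := by
  unfold Spq.spacing
  split_ifs with h
  · obtain ⟨m, rfl⟩ := h
    exact ⟨m, by push_cast; ring⟩
  · exact ⟨p, by ring⟩

lemma Spq.exists_two_pi_mul_eq (p q : ℤ) : ∃ m : ℤ, (q : ℝ) * (2 * π) = Spq.spacing p * m := by
  unfold Spq.spacing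
  split_ifs
  · exact ⟨q, by ring⟩
  · exact ⟨2 * q, by push_cast; ring⟩

lemma mem_Spq_iff {p q : ℤ} {x : ℝ × ℝ} :
    x ∈ Spq p q ↔ ∃ k : ℤ, (p : ℝ) * x.1 + q * x.2 = Spq.spacing p * k := by
  simp only [Spq, Set.mem_ofPred_eq, Spq.spacing]
  split_ifs with h
  · obtain ⟨m, rfl⟩ := h
    refine ⟨?_, Or.inl⟩
    rintro (h | ⟨k, hk⟩)
    · exact h
    · refine ⟨k - m, ?_⟩
      push_cast at hk ⊢
      linarith
  · obtain ⟨m, rfl⟩ := Int.not_even_iff_odd.1 h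
    constructor
    · rintro (⟨k, hk⟩ | ⟨k, hk⟩)
      · exact ⟨2 * k, by push_cast at hk ⊢; linarith⟩
      · exact ⟨2 * k - 2 * m - 1, by push_cast at hk ⊢; linarith⟩
    · rintro ⟨k, hk⟩
      rcases Int.even_or_odd' k with ⟨j, rfl | rfl⟩
      · exact Or.inl ⟨j, by push_cast at hk ⊢; linarith⟩
      · exact Or.inr ⟨j + m + 1, by push_cast at hk ⊢; linarith⟩

lemma zero_mem_Spq (p q : ℤ) : (0 : ℝ × ℝ) ∈ Spq p q :=
  mem_Spq_iff.2 ⟨0, by simp⟩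

lemma sub_int_mul_pi_mem_Spq {p q : ℤ} {x : ℝ × ℝ} (hx : x ∈ Spq p q) (n : ℤ) :
    (x.1 - n * π, x.2) ∈ Spq p q := by
  obtain ⟨k, hk⟩ := mem_Spq_iff.1 hx
  obtain ⟨m, hm⟩ := Spq.exists_mul_pi_eq p
  refine mem_Spq_iff.2 ⟨k - n * m, ?_⟩
  push_cast
  linear_combination hk - n * hm

lemma rotate_mem_Spq {p q : ℤ} {x : ℝ × ℝ} (hx : x ∈ Spq p q) :
    (-x.1, 2 * π - x.2) ∈ Spq p q := by
  obtain ⟨k, hk⟩ := mem_Spq_iff.1 hx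
  obtain ⟨m, hm⟩ := Spq.exists_two_pi_mul_eq p q
  refine mem_Spq_iff.2 ⟨m - k, ?_⟩
  push_cast
  linear_combination hm - hk

lemma add_slope_mem_Spq {p q : ℤ} (hq : q ≠ 0) {x : ℝ × ℝ} (hx : x ∈ Spq p q) (t : ℝ) :
    (x.1 + t, x.2 + -((p : ℝ) / q) * t) ∈ Spq p q := by
  obtain ⟨k, hk⟩ := mem_Spq_iff.1 hx
  have hq' : (q : ℝ) ≠ 0 := by exact_mod_cast hq
  refine mem_Spq_iff.2 ⟨k, ?_⟩
  rw [← hk]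
  field_simp
  ring

/-- The horizontal distance between adjacent points of `S(p'/q')` on a line of `S(p/q)`. -/
noncomputable def Spq.step (p q p' q' : ℤ) : ℝ :=
  Spq.spacing p' * |(q : ℝ)| / |((p * q' - p' * q : ℤ) : ℝ)|

lemma Spq.step_pos {p q p' q' : ℤ} (hq : q ≠ 0) (hΔ : p * q' - p' * q ≠ 0) :
    0 < Spq.step p q p' q' := by
  have := Spq.spacing_pos p'
  unfold Spq.step
  positivity

lemma dd_eq (p q p' q' : ℤ) (hq : q ≠ 0) :
    dd p q p' q' = |(p : ℝ) / q| * Spq.step p q p' q' := by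
  have hq' : |(q : ℝ)| ≠ 0 := by simpa using hq
  rw [abs_div]
  unfold dd Spq.step Spq.spacing
  split_ifs <;> field_simp

lemma add_step_mem_Spq {p q p' q' : ℤ} (hq : q ≠ 0) (hΔ : p * q' - p' * q ≠ 0)
    {x : ℝ × ℝ} (hx : x ∈ Spq p' q') :
    (x.1 + Spq.step p q p' q', x.2 + -((p : ℝ) / q) * Spq.step p q p' q') ∈ Spq p' q' := by
  obtain ⟨k, hk⟩ := mem_Spq_iff.1 hx
  have hq' : (q : ℝ) ≠ 0 := by exact_mod_cast hq
  have hΔ' : ((p * q' - p' * q : ℤ) : ℝ) ≠ 0 := by exact_mod_cast hΔ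
  have key : (p' : ℝ) * Spq.step p q p' q' + q' * (-((p : ℝ) / q) * Spq.step p q p' q') =
      -Spq.spacing p' * ((|(q : ℝ)| / q) *
        (((p * q' - p' * q : ℤ) : ℝ) / |((p * q' - p' * q : ℤ) : ℝ)|)) := by
    have : |((p * q' - p' * q : ℤ) : ℝ)| ≠ 0 := abs_ne_zero.2 hΔ'
    unfold Spq.step
    generalize hD : |((p * q' - p' * q : ℤ) : ℝ)| = D at *
    field_simp
    push_cast
    ring
  obtain ⟨m, hm⟩ : ∃ m : ℤ, (|(q : ℝ)| / q) *
      (((p * q' - p' * q : ℤ) : ℝ) / |((p * q' - p' * q : ℤ) : ℝ)|) = m := by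
    rcases abs_choice (q : ℝ) with h | h <;>
    rcases abs_choice ((p * q' - p' * q : ℤ) : ℝ) with h' | h' <;> rw [h, h']
    · exact ⟨1, by rw [div_self hq', div_self hΔ']; simp⟩
    · exact ⟨-1, by rw [div_self hq', div_neg, div_self hΔ']; simp⟩
    · exact ⟨-1, by rw [neg_div, div_self hq', div_self hΔ']; simp⟩
    · exact ⟨1, by rw [neg_div, div_self hq', div_neg, div_self hΔ']; simp⟩
  rw [hm] at key
  refine mem_Spq_iff.2 ⟨k - m, ?_⟩
  push_cast
  linear_combination hk + key

/-- If from each point of `X` one can move to the right inside `S` to another point of `X`, both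
along a segment of positive slope and along one of negative slope, whose heights add up to less
than `h`, then `S` contains arbitrarily long graphs over intervals of functions with values
in `(0, h)`. -/
lemma exists_zigzag {S X : Set (ℝ × ℝ)} {s₁ s₂ a₁ a₂ h : ℝ} (hs₁ : 0 < s₁) (hs₂ : s₂ < 0)
    (ha₁ : 0 < a₁) (ha₂ : 0 < a₂) (hh : s₁ * a₁ - s₂ * a₂ < h)
    (hS₁ : ∀ x ∈ X, ∀ t, (x.1 + t, x.2 + s₁ * t) ∈ S)
    (hS₂ : ∀ x ∈ X, ∀ t, (x.1 + t, x.2 + s₂ * t) ∈ S)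
    (hX₁ : ∀ x ∈ X, (x.1 + a₁, x.2 + s₁ * a₁) ∈ X)
    (hX₂ : ∀ x ∈ X, (x.1 + a₂, x.2 + s₂ * a₂) ∈ X)
    {x : ℝ × ℝ} (hx : x ∈ X) (hx0 : 0 < x.2) (hxh : x.2 < h) (T : ℝ) :
    ∃ f : ℝ → ℝ, Continuous f ∧
      ∀ θ ∈ Set.Icc x.1 T, 0 < f θ ∧ f θ < h ∧ (θ, f θ) ∈ S := by
  have key (n : ℕ) : ∃ (f : ℝ → ℝ) (b : ℝ), Continuous f ∧ x.1 + n * min a₁ a₂ ≤ b ∧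
      (b, f b) ∈ X ∧ ∀ θ ∈ Set.Icc x.1 b, 0 < f θ ∧ f θ < h ∧ (θ, f θ) ∈ S := by
    induction n with
    | zero =>
      refine ⟨fun _ ↦ x.2, x.1, continuous_const, by simp, hx, fun θ hθ ↦ ?_⟩
      obtain rfl : θ = x.1 := le_antisymm hθ.2 hθ.1
      exact ⟨hx0, hxh, by simpa using hS₁ x hx 0⟩
    | succ n ih =>
      obtain ⟨f, b, hf, hb, hbX, hfS⟩ := ih
      have hb' : x.1 ≤ b := le_trans (by have := lt_min ha₁ ha₂; simp; positivity) hb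
      obtain ⟨hfb0, hfbh, -⟩ := hfS b ⟨hb', le_rfl⟩
      obtain ⟨s, a, ha, hmin, hX, hS, h0, hlt⟩ : ∃ s a : ℝ, 0 < a ∧ min a₁ a₂ ≤ a ∧
          (b + a, f b + s * a) ∈ X ∧ (∀ t, (b + t, f b + s * t) ∈ S) ∧
          (0 < f b + s * a) ∧ f b + s * a < h := by
        rcases lt_or_ge (f b + s₁ * a₁) h with hlt | hge
        · exact ⟨s₁, a₁, ha₁, min_le_left .., hX₁ _ hbX, hS₁ _ hbX, by positivity, hlt⟩
        · exact ⟨s₂, a₂, ha₂, min_le_right .., hX₂ _ hbX, hS₂ _ hbX, by linarith,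
            by nlinarith⟩
      refine ⟨fun θ ↦ f (min θ b) + s * max (θ - b) 0, b + a, by fun_prop, ?_, ?_, ?_⟩
      · push_cast
        linarith
      · simpa [ha.le] using hX
      · rintro θ ⟨hθ, hθ'⟩
        rcases le_total θ b with hle | hle
        · simpa [hle] using hfS θ ⟨hθ, hle⟩
        · have hp : 0 ≤ θ - b := by linarith
          simp only [min_eq_right hle, max_eq_left hp]
          refine ⟨?_, ?_, by simpa using hS (θ - b)⟩
          · rcases le_total 0 s with hs | hs <;> nlinarith
          · rcases le_total 0 s with hs | hs <;> nlinarith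
  obtain ⟨n, hn⟩ := exists_nat_ge ((T - x.1) / min a₁ a₂)
  obtain ⟨f, b, hf, hb, -, hfS⟩ := key n
  have : T - x.1 ≤ n * min a₁ a₂ := (div_le_iff₀ (lt_min ha₁ ha₂)).1 hn
  exact ⟨f, hf, fun θ hθ ↦ hfS θ ⟨hθ.1, by linarith [hθ.2]⟩⟩

lemma sub_int_mul_mem {K : Set (ℝ × ℝ)} {T : ℝ}
    (hKT : ∀ x : ℝ × ℝ, x ∈ K → (x.1 + T, x.2) ∈ K)
    (hKT' : ∀ x : ℝ × ℝ, x ∈ K → (x.1 - T, x.2) ∈ K) {x : ℝ × ℝ} (hx : x ∈ K) (n : ℤ) :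
    (x.1 - n * T, x.2) ∈ K := by
  induction n with
  | zero => simpa using hx
  | succ n ih => convert hKT' _ ih using 2; push_cast; ring
  | pred n ih => convert hKT _ ih using 2; push_cast; ring

/-- A continuous odd periodic function whose graph avoids a periodic closed set can be replaced by
a smooth one. -/
lemma exists_contDiff_odd_periodic {K : Set (ℝ × ℝ)} (hK : IsClosed K) {T : ℝ} (hT : 0 < T)
    (hKT : ∀ x : ℝ × ℝ, x ∈ K → (x.1 + T, x.2) ∈ K)
    (hKT' : ∀ x : ℝ × ℝ, x ∈ K → (x.1 - T, x.2) ∈ K)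
    {f : ℝ → ℝ} (hf : Continuous f) (hodd : ∀ x, f (-x) = -f x) (hper : Function.Periodic f T)
    (hfK : ∀ x, (x, f x) ∉ K) :
    ∃ g : ℝ → ℝ, ContDiff ℝ (⊤ : ℕ∞) g ∧ (∀ x, g (-x) = -g x) ∧ Function.Periodic g T ∧
      ∀ x, (x, g x) ∉ K := by
  let G : ℝ → ℝ × ℝ := fun x ↦ (x, f x)
  have hG : IsCompact (G '' Set.Icc 0 T) := isCompact_Icc.image (by fun_prop)
  obtain ⟨ε, hε, hεK⟩ := hG.exists_thickening_subset_open hK.isOpen_compl (by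
    rintro _ ⟨x, -, rfl⟩
    exact hfK x)
  obtain ⟨δ, hδ, hfδ⟩ := Metric.mem_uniformity_dist.1
    (isCompact_Icc.uniformContinuousAt_of_continuousAt (s := Set.Icc 0 T) f
      (fun _ _ ↦ hf.continuousAt) (Metric.dist_mem_uniformity (half_pos hε)))
  let φ : ContDiffBump (0 : ℝ) := ⟨δ / 2, δ, half_pos hδ, half_lt_self hδ⟩
  let g : ℝ → ℝ := MeasureTheory.convolution (φ.normed MeasureTheory.volume) f
    (ContinuousLinearMap.lsmul ℝ ℝ) MeasureTheory.volume
  have hg (x : ℝ) : g x = ∫ t, φ.normed MeasureTheory.volume t * f (x - t) := rfl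
  have hgper : Function.Periodic g T := fun x ↦ by
    rw [hg, hg]
    refine MeasureTheory.integral_congr_ae (.of_forall fun t ↦ ?_)
    simp only [add_sub_right_comm, hper _]
  refine ⟨g, ?_, fun x ↦ ?_, hgper, fun x hx ↦ ?_⟩
  · exact φ.hasCompactSupport_normed.contDiff_convolution_left _ φ.contDiff_normed
      hf.locallyIntegrable
  · rw [hg, hg, ← MeasureTheory.integral_neg_eq_self, ← MeasureTheory.integral_neg]
    refine MeasureTheory.integral_congr_ae (.of_forall fun t ↦ ?_)
    simp only [φ.normed_neg, ← mul_neg, ← hodd]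
    ring_nf
  · obtain ⟨n, hn, -⟩ := existsUnique_zsmul_near_of_pos' hT x
    rw [zsmul_eq_mul] at hn
    have hgx : g (x - n * T) = g x := hgper.sub_int_mul_eq n
    have hmem := sub_int_mul_mem hKT hKT' hx n
    rw [← hgx] at hmem
    refine hεK ?_ hmem
    refine Metric.mem_thickening_iff.2 ⟨_, ⟨x - n * T, ⟨hn.1, hn.2.le⟩, rfl⟩, ?_⟩
    have hdist : dist (g (x - n * T)) (f (x - n * T)) ≤ ε / 2 := by
      refine φ.dist_normed_convolution_le hf.aestronglyMeasurable fun y hy ↦ ?_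
      rw [dist_comm]
      exact (hfδ (by rw [dist_comm]; exact hy) ⟨hn.1, hn.2.le⟩).le
    rw [Prod.dist_eq, dist_self]
    exact max_lt hε (by linarith)

/-- A continuous function on `[0, π]` can be cut off near the end points and extended to an odd
`2π`-periodic function. -/
lemma exists_odd_periodic_avoiding {K : Set (ℝ × ℝ)}
    (hKT : ∀ x : ℝ × ℝ, x ∈ K → (x.1 + 2 * π, x.2) ∈ K)
    (hKT' : ∀ x : ℝ × ℝ, x ∈ K → (x.1 - 2 * π, x.2) ∈ K)
    (hKneg : ∀ x : ℝ × ℝ, x ∈ K → -x ∈ K)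
    {ε h : ℝ} (hε : 0 < ε)
    (h0 : ∀ x ∈ K, |x.1| ≤ ε → h ≤ |x.2|) (hπ : ∀ x ∈ K, |x.1 - π| ≤ ε → h ≤ |x.2|)
    {f : ℝ → ℝ} (hf : Continuous f) (hfh : ∀ θ ∈ Set.Icc 0 π, |f θ| < h)
    (hfK : ∀ θ ∈ Set.Icc 0 π, (θ, f θ) ∉ K) :
    ∃ g : ℝ → ℝ, Continuous g ∧ (∀ x, g (-x) = -g x) ∧ Function.Periodic g (2 * π) ∧
      ∀ x, (x, g x) ∉ K := by
  let s : ℝ := sin (min ε (π / 2))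
  have hm : 0 < min ε (π / 2) := lt_min hε (by positivity)
  have hs : 0 < s := sin_pos_of_pos_of_lt_pi hm
    ((min_le_right _ _).trans_lt (by linarith [pi_pos]))
  let χ : ℝ → ℝ := fun θ ↦ max (-1) (min 1 (sin θ / s))
  have hχneg (θ : ℝ) : χ (-θ) = -χ θ := by
    simp only [χ, sin_neg, neg_div]
    rcases le_total 1 (sin θ / s) with h1 | h1 <;> rcases le_total (-1) (sin θ / s) with h2 | h2 <;>
      grind
  let g : ℝ → ℝ := fun θ ↦ f (arccos (cos θ)) * χ θ
  have hgneg (θ : ℝ) : g (-θ) = -g θ := by simp [g, hχneg]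
  have hgper : Function.Periodic g (2 * π) := fun θ ↦ by simp [g, χ]
  have hgIcc (θ : ℝ) (hθ : θ ∈ Set.Icc 0 π) : (θ, g θ) ∉ K := by
    have hg : g θ = f θ * χ θ := by simp only [g, arccos_cos hθ.1 hθ.2]
    have hsin : ∀ t, 0 ≤ t → t ≤ π / 2 → sin t < s → |t| ≤ ε := fun t ht ht' hts ↦ by
      rw [abs_of_nonneg ht]
      refine le_trans ?_ (min_le_left ε (π / 2))
      by_contra! hlt
      exact hts.not_ge (sin_le_sin_of_le_of_le_pi_div_two (by linarith [pi_pos]) ht' hlt.le)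
    rcases le_or_gt s (sin θ) with hle | hlt
    · have : 1 ≤ sin θ / s := (one_le_div hs).2 hle
      have : χ θ = 1 := by simp [χ, this]
      rw [hg, this, mul_one]
      exact hfK θ hθ
    · have hlt' : |g θ| < h := by
        refine lt_of_le_of_lt ?_ (hfh θ hθ)
        rw [hg, abs_mul]
        refine mul_le_of_le_one_right (abs_nonneg _) (abs_le.2 ⟨le_max_left .., ?_⟩)
        exact max_le (by norm_num) (min_le_left ..)
      intro hmem
      rcases le_total θ (π / 2) with h2 | h2
      · exact hlt'.not_ge (h0 _ hmem (hsin θ hθ.1 h2 hlt))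
      · refine hlt'.not_ge (hπ _ hmem ?_)
        rw [abs_sub_comm]
        exact hsin (π - θ) (by linarith [hθ.2]) (by linarith) (by rwa [sin_pi_sub])
  refine ⟨g, by fun_prop (disch := exact hs.ne'), hgneg, hgper, fun θ hθ ↦ ?_⟩
  have hmem : arccos (cos θ) ∈ Set.Icc 0 π := ⟨arccos_nonneg _, arccos_le_pi _⟩
  obtain ⟨k, hk | hk⟩ := cos_eq_cos_iff.1 (cos_arccos (neg_one_le_cos θ) (cos_le_one θ))
  · have h1 : θ - k * (2 * π) = arccos (cos θ) := by linarith
    have h2 := sub_int_mul_mem hKT hKT' hθ k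
    rw [← hgper.sub_int_mul_eq k] at h2
    simp only [h1] at h2
    exact hgIcc _ hmem h2
  · have h1 : θ - k * (2 * π) = -arccos (cos θ) := by linarith
    have h2 := sub_int_mul_mem hKT hKT' hθ k
    rw [← hgper.sub_int_mul_eq k] at h2
    simp only [h1, hgneg] at h2
    exact hgIcc _ hmem (by simpa using hKneg _ h2)

/-- In the situation of opposite signs, `S(p₁/q₁) ∪ S(p₂/q₂)` contains the graph over `[0, π]` of
a continuous function with values in `(0, 2π)`. -/
lemma exists_graph_subset_Spq_union {p₁ q₁ p₂ q₂ : ℤ} (hq₁ : q₁ ≠ 0) (hq₂ : q₂ ≠ 0)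
    (hr₁ : (p₁ : ℝ) / q₁ < 0) (hr₂ : 0 < (p₂ : ℝ) / q₂)
    (hd : dd p₁ q₁ p₂ q₂ + dd p₂ q₂ p₁ q₁ < 2 * π) :
    ∃ f : ℝ → ℝ, Continuous f ∧
      ∀ θ ∈ Set.Icc 0 π, 0 < f θ ∧ f θ < 2 * π ∧ (θ, f θ) ∈ Spq p₁ q₁ ∪ Spq p₂ q₂ := by
  have hΔ : p₁ * q₂ - p₂ * q₁ ≠ 0 := by
    intro h
    have hq₁' : (q₁ : ℝ) ≠ 0 := by exact_mod_cast hq₁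
    have hq₂' : (q₂ : ℝ) ≠ 0 := by exact_mod_cast hq₂
    have : (p₁ : ℝ) / q₁ = p₂ / q₂ := by
      rw [div_eq_div_iff hq₁' hq₂']
      exact_mod_cast sub_eq_zero.1 h
    linarith
  have hΔ' : p₂ * q₁ - p₁ * q₂ ≠ 0 := by omega
  rw [dd_eq _ _ _ _ hq₁, dd_eq _ _ _ _ hq₂, abs_of_neg hr₁, abs_of_pos hr₂] at hd
  have ha₁ := Spq.step_pos hq₁ hΔ
  have ha₂ := Spq.step_pos hq₂ hΔ'
  have hX₁ : ∀ x ∈ Spq p₁ q₁ ∩ Spq p₂ q₂, (x.1 + Spq.step p₁ q₁ p₂ q₂,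
      x.2 + -((p₁ : ℝ) / q₁) * Spq.step p₁ q₁ p₂ q₂) ∈ Spq p₁ q₁ ∩ Spq p₂ q₂ :=
    fun x hx ↦ ⟨add_slope_mem_Spq hq₁ hx.1 _, add_step_mem_Spq hq₁ hΔ hx.2⟩
  have hX₂ : ∀ x ∈ Spq p₁ q₁ ∩ Spq p₂ q₂, (x.1 + Spq.step p₂ q₂ p₁ q₁,
      x.2 + -((p₂ : ℝ) / q₂) * Spq.step p₂ q₂ p₁ q₁) ∈ Spq p₁ q₁ ∩ Spq p₂ q₂ :=
    fun x hx ↦ ⟨add_step_mem_Spq hq₂ hΔ' hx.1, add_slope_mem_Spq hq₂ hx.2 _⟩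
  have h0 := hX₁ 0 ⟨zero_mem_Spq _ _, zero_mem_Spq _ _⟩
  simp only [Prod.fst_zero, Prod.snd_zero, zero_add] at h0
  obtain ⟨n, hn⟩ := exists_nat_ge (Spq.step p₁ q₁ p₂ q₂ / π)
  rw [div_le_iff₀ pi_pos] at hn
  have hd₁ := mul_pos (neg_pos.2 hr₁) ha₁
  have hd₂ := mul_pos hr₂ ha₂
  obtain ⟨f, hf, hfS⟩ := exists_zigzag (S := Spq p₁ q₁ ∪ Spq p₂ q₂) (h := 2 * π)
    (neg_pos.2 hr₁) (neg_neg_of_pos hr₂) ha₁ ha₂ (by linarith)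
    (fun x hx t ↦ Or.inl (add_slope_mem_Spq hq₁ hx.1 t))
    (fun x hx t ↦ Or.inr (add_slope_mem_Spq hq₂ hx.2 t)) hX₁ hX₂
    (x := (Spq.step p₁ q₁ p₂ q₂ - (n : ℤ) * π, -((p₁ : ℝ) / q₁) * Spq.step p₁ q₁ p₂ q₂))
    ⟨sub_int_mul_pi_mem_Spq h0.1 n, sub_int_mul_pi_mem_Spq h0.2 n⟩ hd₁
    (by simp only; linarith) π
  exact ⟨f, hf, fun θ hθ ↦ hfS θ ⟨by push_cast; linarith [hθ.1], hθ.2⟩⟩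

/-- Geometric core of the opposite-sign case of the main theorem.  If `r₁ < -2 < 2 < r₂`
with `d₁ + d₂ < 2π`, and `C` is a closed set which is invariant under `(θ,η) ↦ (θ+π,η)`
and `(θ,η) ↦ (θ,η+2π)`, meets an `ε`-neighbourhood of the vertical lines `θ ∈ πℤ` only
at heights `η ∈ 2πℤ`, and meets `S(r₁) ∪ S(r₂)` only at heights `η ∈ 2πℤ`, then there is
a smooth odd `2π`-periodic function `g` with `|g| < π` whose graph, shifted up by `π`,
avoids `C`. -/
theorem statement_11 (p₁ q₁ p₂ q₂ : ℤ) (hq₁ : q₁ ≠ 0) (hq₂ : q₂ ≠ 0)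
    (hc₁ : IsCoprime p₁ q₁) (hc₂ : IsCoprime p₂ q₂)
    (hr₁ : (p₁ : ℝ) / q₁ < -2) (hr₂ : 2 < (p₂ : ℝ) / q₂)
    (hd : dd p₁ q₁ p₂ q₂ + dd p₂ q₂ p₁ q₁ < 2 * π)
    (C : Set (ℝ × ℝ)) (hC : IsClosed C)
    (hinv₁ : ∀ x : ℝ × ℝ, x ∈ C ↔ (x.1 + π, x.2) ∈ C)
    (hinv₂ : ∀ x : ℝ × ℝ, x ∈ C ↔ (x.1, x.2 + 2 * π) ∈ C)
    (hvert : ∃ ε > 0, ∀ x ∈ C, (∃ k : ℤ, |x.1 - (k : ℝ) * π| ≤ ε) →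
      ∃ k : ℤ, x.2 = 2 * π * (k : ℝ))
    (hS : ∀ x ∈ C ∩ (Spq p₁ q₁ ∪ Spq p₂ q₂), ∃ k : ℤ, x.2 = 2 * π * (k : ℝ)) :
    ∃ g : ℝ → ℝ, ContDiff ℝ (⊤ : ℕ∞) g ∧ (∀ x, g (-x) = -g x) ∧
      Function.Periodic g (2 * π) ∧ (∀ x, |g x| < π) ∧
      ∀ x ∈ C, x.2 - π ≠ g x.1 := by
  obtain ⟨ε, hε, hvert⟩ := hvert
  obtain ⟨f, hf, hfS⟩ := exists_graph_subset_Spq_union hq₁ hq₂ (by linarith) (by linarith) hd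
  have hstrip {y : ℝ} (hy : |y| < π) : ¬∃ k : ℤ, y + π = 2 * π * k := by
    rintro ⟨k, hk⟩
    obtain ⟨hy₁, hy₂⟩ := abs_lt.1 hy
    have h1 : (0 : ℝ) < k := by
      by_contra! h
      nlinarith [pi_pos]
    have h2 : (k : ℝ) < 1 := by
      by_contra! h
      nlinarith [pi_pos]
    norm_cast at h1 h2
    omega
  have hshift (x : ℝ × ℝ) : x ∈ C ↔ (x.1 + 2 * π, x.2) ∈ C := by
    rw [hinv₁, hinv₁, add_assoc, ← two_mul]
  let K : Set (ℝ × ℝ) := {x | (x.1, x.2 + π) ∈ C ∨ (-x.1, -x.2 + π) ∈ C ∨ π ≤ |x.2|}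
  have hK : IsClosed K :=
    (hC.preimage (f := fun x : ℝ × ℝ ↦ (x.1, x.2 + π)) (by fun_prop)).union
      ((hC.preimage (f := fun x : ℝ × ℝ ↦ (-x.1, -x.2 + π)) (by fun_prop)).union
        (isClosed_le continuous_const continuous_snd.abs))
  have hKT (x : ℝ × ℝ) (hx : x ∈ K) : (x.1 + 2 * π, x.2) ∈ K := by
    refine hx.imp (hshift _).1 (Or.imp_left fun h ↦ (hshift _).2 ?_)
    simpa using h
  have hKT' (x : ℝ × ℝ) (hx : x ∈ K) : (x.1 - 2 * π, x.2) ∈ K := by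
    refine hx.imp (fun h ↦ (hshift _).2 ?_) (Or.imp_left fun h ↦ ?_)
    · simpa using h
    · simpa [neg_add_eq_sub] using (hshift _).1 h
  have hKneg (x : ℝ × ℝ) (hx : x ∈ K) : -x ∈ K := by
    rcases hx with h | h | h
    · exact Or.inr (Or.inl (by simpa using h))
    · exact Or.inl h
    · exact Or.inr (Or.inr (by simpa using h))
  have hKvert (k : ℤ) (x : ℝ × ℝ) (hx : x ∈ K) (hxk : |x.1 - k * π| ≤ ε) : π ≤ |x.2| := by
    by_contra! hlt
    rcases hx with h | h | h
    · exact hstrip hlt (hvert _ h ⟨k, hxk⟩)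
    · refine hstrip (by rwa [abs_neg]) (hvert _ h ⟨-k, ?_⟩)
      rw [← abs_neg]
      convert hxk using 2
      push_cast
      ring
    · exact hlt.not_ge h
  obtain ⟨g₀, hg₀, hg₀neg, hg₀per, hg₀K⟩ := exists_odd_periodic_avoiding (h := π)
    (f := fun θ ↦ f θ - π) hKT hKT' hKneg hε
    (fun x hx h ↦ hKvert 0 x hx (by simpa using h))
    (fun x hx h ↦ hKvert 1 x hx (by simpa using h))
    (by fun_prop)
    (fun θ hθ ↦ abs_lt.2 ⟨by linarith [hfS θ hθ], by linarith [hfS θ hθ]⟩) (by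
      intro θ hθ hmem
      obtain ⟨hf0, hf2, hfθ⟩ := hfS θ hθ
      have hlt : |f θ - π| < π := abs_lt.2 ⟨by linarith, by linarith⟩
      rcases hmem with h | h | h
      · exact hstrip hlt (hS _ ⟨h, by simpa using hfθ⟩)
      · refine hstrip (by rwa [abs_neg]) (hS _ ⟨h, ?_⟩)
        have hrot : -(f θ - π) + π = 2 * π - f θ := by ring
        simp only [hrot]
        exact hfθ.imp rotate_mem_Spq rotate_mem_Spq
      · exact hlt.not_ge h)
  obtain ⟨g, hg, hgneg, hgper, hgK⟩ :=
    exists_contDiff_odd_periodic hK two_pi_pos hKT hKT' hg₀ hg₀neg hg₀per hg₀K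
  refine ⟨g, hg, hgneg, hgper, fun x ↦ ?_, fun x hx hxg ↦ hgK x.1 (Or.inl ?_)⟩
  · by_contra! h
    exact hgK x (Or.inr (Or.inr h))
  · rw [← hxg]
    simpa using hx
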